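/- Let n ≥ 2 and let b ∈ Vec_n be any bracket vector of size n. If b is t-Pop-sortable, then its hash b^# ∈ Vec_{n-1} is t-Pop-sortable. -/

import Mathlib

open scoped Classical

/-- `b` is a bracket vector of size `n`: a tuple `(b_0, …, b_{2n-1})` with
`b_{2k+1} = k`, `⌊i/2⌋ ≤ b_i ≤ n-1`, and such that `b_i = k` forces `b_j ≤ k`
for all `i+1 ≤ j ≤ 2k+1`. -/
def IsBracketVec (n : ℕ) (b : List ℕ) : Prop :=
  b.length = 2 * n ∧
    (∀ k : ℕ, k < n → b.getD (2 * k + 1) 0 = k) ∧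
    (∀ i : ℕ, i < 2 * n → i / 2 ≤ b.getD i 0 ∧ b.getD i 0 ≤ n - 1) ∧
    (∀ i : ℕ, i < 2 * n → ∀ j : ℕ, i + 1 ≤ j → j ≤ 2 * b.getD i 0 + 1 →
      b.getD j 0 ≤ b.getD i 0)

/-- The minimum bracket vector `m_n`, with `(m_n)_i = ⌊i/2⌋`. -/
def minVec (n : ℕ) : List ℕ := (List.range (2 * n)).map (fun i => i / 2)

/-- The entries of the image of a bracket vector of size `n` under `Pop`:
`η_i(b) = b_i` if `i = 2n-1` or `b_i ≤ b_{i+1}`, and otherwise `η_i(b)` is the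
largest `x` with `⌊i/2⌋ ≤ x ≤ b_i - 1` and `b_j ≤ x` for all `i+1 ≤ j ≤ 2x+1`. -/
noncomputable def eta (n : ℕ) (b : List ℕ) (i : ℕ) : ℕ :=
  if i = 2 * n - 1 ∨ b.getD i 0 ≤ b.getD (i + 1) 0 then b.getD i 0
  else ((Finset.range (b.getD i 0)).filter
      (fun x => i / 2 ≤ x ∧ ∀ j ∈ Finset.Icc (i + 1) (2 * x + 1), b.getD j 0 ≤ x)).sup id

/-- The `Pop` operator on bracket vectors of size `n`. -/
noncomputable def popVec (n : ℕ) (b : List ℕ) : List ℕ := (List.range (2 * n)).map (eta n b)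

/-- A bracket vector of size `n` is `t`-Pop-sortable if `t` applications of `Pop`
yield the minimum vector `m_n`. -/
def PopSortable (n t : ℕ) (b : List ℕ) : Prop := (popVec n)^[t] b = minVec n

/-- A bracket vector of size `n` is irreducible if `b_0 = b_{2n-1}`. -/
def IsIrredVec (n : ℕ) (b : List ℕ) : Prop :=
  IsBracketVec n b ∧ b.getD 0 0 = b.getD (2 * n - 1) 0

/-- The sum of a list of bracket vectors: the vector of `b ∈ Vec_{n₁}` and
`b' ∈ Vec_{n₂}` is `(b_0, …, b_{2n₁-1}, b'_0 + n₁, …, b'_{2n₂-1} + n₁) ∈ Vec_{n₁+n₂}`. -/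
def sumVecs : List (List ℕ) → List ℕ
  | [] => []
  | v :: L => v ++ (sumVecs L).map (· + v.length / 2)

/-- `L` is a decomposition of `b` into (nonempty) irreducible bracket vectors. -/
def IsIrredDecomp (b : List ℕ) (L : List (List ℕ)) : Prop :=
  (∀ v ∈ L, 1 ≤ v.length / 2 ∧ IsIrredVec (v.length / 2) v) ∧ b = sumVecs L

/-- The hash of a bracket vector: delete the first two entries and subtract `1`
from all remaining entries. -/
def hashVec (b : List ℕ) : List ℕ := (b.drop 2).map (· - 1)
/-- The vector has length `2 * n`, satisfies `b_i ≥ ⌊i/2⌋`, with equality at odd `i`.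
This is the part of `IsBracketVec` that suffices for `hashVec` to commute with `popVec`. -/
structure IsLowerBounded (n : ℕ) (b : List ℕ) : Prop where
  length_eq : b.length = 2 * n
  getD_odd : ∀ k < n, b.getD (2 * k + 1) 0 = k
  div_two_le : ∀ i < 2 * n, i / 2 ≤ b.getD i 0

theorem IsBracketVec.isLowerBounded {n : ℕ} {b : List ℕ} (hb : IsBracketVec n b) :
    IsLowerBounded n b :=
  ⟨hb.1, hb.2.1, fun i hi => (hb.2.2.1 i hi).1⟩

theorem length_popVec (n : ℕ) (b : List ℕ) : (popVec n b).length = 2 * n := by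
  simp [popVec]

theorem getD_popVec {n i : ℕ} (b : List ℕ) (hi : i < 2 * n) :
    (popVec n b).getD i 0 = eta n b i := by
  simp [popVec, List.getD_eq_getElem?_getD, hi]

theorem getD_hashVec (b : List ℕ) (i : ℕ) :
    (hashVec b).getD i 0 = b.getD (i + 2) 0 - 1 := by
  simp only [hashVec, List.getD_eq_getElem?_getD, List.getElem?_map, List.getElem?_drop,
    Nat.add_comm 2 i]
  cases b[i + 2]? <;> simp

theorem IsLowerBounded.div_two_le_eta {n : ℕ} {b : List ℕ} (hb : IsLowerBounded n b) {i : ℕ}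
    (hi : i < 2 * n) : i / 2 ≤ eta n b i := by
  unfold eta
  split_ifs with h
  · exact hb.div_two_le i hi
  · push Not at h
    have hlow := hb.div_two_le (i + 1) (by omega)
    refine Finset.le_sup (f := id) (b := i / 2) ?_
    simp only [Finset.mem_filter, Finset.mem_range, Finset.mem_Icc]
    refine ⟨?_, le_rfl, fun j hj => ?_⟩
    · have := hb.div_two_le i hi
      omega
    · obtain rfl : j = 2 * (i / 2) + 1 := by omega
      exact (hb.getD_odd (i / 2) (by omega)).le

theorem IsLowerBounded.eta_odd {n : ℕ} {b : List ℕ} (hb : IsLowerBounded n b) {k : ℕ}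
    (hk : k < n) : eta n b (2 * k + 1) = k := by
  have hodd := hb.getD_odd k hk
  have h : 2 * k + 1 = 2 * n - 1 ∨ b.getD (2 * k + 1) 0 ≤ b.getD (2 * k + 1 + 1) 0 := by
    by_cases hlast : 2 * k + 1 = 2 * n - 1
    · exact Or.inl hlast
    · have := hb.div_two_le (2 * k + 1 + 1) (by omega)
      omega
  rw [eta, if_pos h, hodd]

theorem IsLowerBounded.popVec {n : ℕ} {b : List ℕ} (hb : IsLowerBounded n b) :
    IsLowerBounded n (popVec n b) where
  length_eq := length_popVec n b
  getD_odd k hk := by rw [getD_popVec b (by omega), hb.eta_odd hk]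
  div_two_le i hi := by rw [getD_popVec b hi]; exact hb.div_two_le_eta hi

theorem IsLowerBounded.eta_hashVec {n : ℕ} {b : List ℕ} (hb : IsLowerBounded n b) {i : ℕ}
    (hi : i < 2 * (n - 1)) : eta (n - 1) (hashVec b) i = eta n b (i + 2) - 1 := by
  have hpos := hb.div_two_le (i + 2) (by omega)
  have hcond : (i = 2 * (n - 1) - 1 ∨ (hashVec b).getD i 0 ≤ (hashVec b).getD (i + 1) 0) ↔
      (i + 2 = 2 * n - 1 ∨ b.getD (i + 2) 0 ≤ b.getD (i + 2 + 1) 0) := by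
    by_cases hlast : i + 2 = 2 * n - 1
    · simp only [hlast, true_or, iff_true]
      omega
    · have := hb.div_two_le (i + 2 + 1) (by omega)
      rw [getD_hashVec, getD_hashVec, show i + 1 + 2 = i + 2 + 1 by omega]
      omega
  unfold eta
  by_cases h : i + 2 = 2 * n - 1 ∨ b.getD (i + 2) 0 ≤ b.getD (i + 2 + 1) 0
  · rw [if_pos h, if_pos (hcond.2 h), getD_hashVec]
  · rw [if_neg h, if_neg (mt hcond.1 h)]
    apply le_antisymm
    · refine Finset.sup_le fun y hy => ?_
      simp only [Finset.mem_filter, Finset.mem_range, Finset.mem_Icc, getD_hashVec] at hy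
      refine Nat.le_sub_of_add_le (Finset.le_sup (f := id) (b := y + 1) ?_)
      simp only [Finset.mem_filter, Finset.mem_range, Finset.mem_Icc]
      refine ⟨by omega, by omega, fun j hj => ?_⟩
      have := hy.2.2 (j - 2) (by omega)
      rw [show j - 2 + 2 = j by omega] at this
      omega
    · refine Nat.sub_le_of_le_add (Finset.sup_le fun x hx => ?_)
      simp only [Finset.mem_filter, Finset.mem_range, Finset.mem_Icc] at hx
      refine Nat.le_add_of_sub_le (Finset.le_sup (f := id) (b := x - 1) ?_)
      simp only [Finset.mem_filter, Finset.mem_range, Finset.mem_Icc, getD_hashVec]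
      refine ⟨by omega, by omega, fun j hj => ?_⟩
      have := hx.2.2 (j + 2) (by omega)
      omega

theorem IsLowerBounded.popVec_hashVec {n : ℕ} {b : List ℕ} (hb : IsLowerBounded n b) :
    _root_.popVec (n - 1) (hashVec b) = hashVec (_root_.popVec n b) := by
  have hlen : (hashVec (_root_.popVec n b)).length = 2 * (n - 1) := by
    simp only [hashVec, List.length_map, List.length_drop, length_popVec]
    omega
  refine List.ext_getElem ((length_popVec _ _).trans hlen.symm) fun i h₁ h₂ => ?_
  have hi : i < 2 * (n - 1) := hlen ▸ h₂
  rw [← List.getD_eq_getElem _ 0 h₁, ← List.getD_eq_getElem _ 0 h₂, getD_popVec _ hi,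
    getD_hashVec, getD_popVec _ (by omega), hb.eta_hashVec hi]

theorem IsLowerBounded.iterate_popVec_hashVec {n : ℕ} (t : ℕ) {b : List ℕ}
    (hb : IsLowerBounded n b) :
    (_root_.popVec (n - 1))^[t] (hashVec b) = hashVec ((_root_.popVec n)^[t] b) := by
  induction t generalizing b with
  | zero => rfl
  | succ t ih => rw [Function.iterate_succ_apply, Function.iterate_succ_apply,
      hb.popVec_hashVec, ih hb.popVec]

theorem hashVec_minVec (n : ℕ) : hashVec (minVec n) = minVec (n - 1) := by
  apply List.ext_getElem
  · simp only [hashVec, minVec, List.length_map, List.length_drop, List.length_range]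
    omega
  · intro i h₁ h₂
    simp only [hashVec, minVec, List.getElem_map, List.getElem_drop, List.getElem_range]
    omega

/-- **Theorem (Statement 9).** For `n ≥ 2` and any bracket vector `b` of size `n`,
if `b` is `t`-Pop-sortable then its hash `b^#` (a bracket vector of size `n - 1`)
is `t`-Pop-sortable. -/
theorem hash_preserves_sortability (n : ℕ) (hn : 2 ≤ n) (t : ℕ) (b : List ℕ)
    (hb : IsBracketVec n b) (hsort : PopSortable n t b) :
    PopSortable (n - 1) t (hashVec b) := by
  unfold PopSortable at hsort ⊢
  rw [hb.isLowerBounded.iterate_popVec_hashVec, hsort, hashVec_minVec]
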